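/- Set p = 1/2 (so b = 2) and let β(n) = α(n) − 1. Suppose n ranges over a sequence of integers with log⁵ n ≤ μ_{α(n)}(n) = O(n/log² n). Then, with high probability, χ(G_{n,1/2}) ≥ k*(n) − (1+ε(n)) · μ·log ν / (α·(log n − log log n)), where α = α(n), μ = μ_{α(n)}(n), ν = (n/log n)/μ, ε(n) = O(1/log ν) → 0, and k*(n) is the function associated to β from Lemma lem:k* (the unique k with L̂₀(n,k,β(n)) = 0 in the interval I_n). -/

import Mathlib

open Filter Real

/-- Number of edges of a graph on `Fin n`. -/
noncomputable def edgeCount {n : ℕ} (G : SimpleGraph (Fin n)) : ℕ := G.edgeSet.ncard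

/-- The probability that the binomial random graph `G_{n,p}` equals `G`. -/
noncomputable def gnpWeight (n : ℕ) (p : ℝ) (G : SimpleGraph (Fin n)) : ℝ :=
  p ^ edgeCount G * (1 - p) ^ (n.choose 2 - edgeCount G)

/-- `P` is a partition of the vertex set of `G` into independent sets, each of size at most
`t`. -/
def IsIndepPartition {n : ℕ} (G : SimpleGraph (Fin n)) (t : ℕ)
    (P : Finset (Finset (Fin n))) : Prop :=
  (∀ S ∈ P, S.Nonempty ∧ S.card ≤ t ∧ ∀ u ∈ S, ∀ v ∈ S, ¬ G.Adj u v) ∧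
  (∀ v : Fin n, ∃! S, S ∈ P ∧ v ∈ S)

/-- The number of unordered `t`-bounded `k`-colourings of `G`. -/
noncomputable def numPartitions {n : ℕ} (k t : ℕ) (G : SimpleGraph (Fin n)) : ℕ :=
  Set.ncard {P : Finset (Finset (Fin n)) | P.card = k ∧ IsIndepPartition G t P}

/-- `E_{n,k,t}`: expected number of unordered `t`-bounded `k`-colourings of `G_{n,1/2}`. -/
noncomputable def EE (n k t : ℕ) : ℝ :=
  ∑ G : SimpleGraph (Fin n), gnpWeight n (1 / 2) G * numPartitions k t G

/-- `k_t(n) = min {k : E_{n,k,t} ≥ 1}`, the `t`-bounded first moment threshold. -/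
noncomputable def kThresh (n t : ℕ) : ℕ := sInf {k : ℕ | 1 ≤ EE n k t}

/-- `α₀(n)` (for `p = 1/2`, take `b = 2`). -/
noncomputable def alpha0 (b : ℝ) (x : ℝ) : ℝ :=
  2 * Real.logb b x - 2 * Real.logb b (Real.logb b x) + 2 * Real.logb b (Real.exp 1 / 2) + 1

/-- `α(n) = ⌊α₀(n)⌋`, as a natural number. -/
noncomputable def alphaNat (b : ℝ) (x : ℝ) : ℕ := (⌊alpha0 b x⌋).toNat

/-- `μ_a(x) = C(x,a) q^C(a,2)` extended to a real variable `x` via the falling factorial. -/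
noncomputable def muR (q : ℝ) (a : ℕ) (x : ℝ) : ℝ :=
  (∏ i ∈ Finset.range a, (x - i)) / (a.factorial : ℝ) * q ^ a.choose 2

/-- `d_i = 2^C(i,2) i!`. -/
noncomputable def dI (i : ℕ) : ℝ := 2 ^ i.choose 2 * (i.factorial : ℝ)

/-- `P̃_{ρ,t}`: the set of `(p_1,…,p_t) ∈ [0,1]^t` with `Σ p_i = 1` and `Σ i p_i = ρ`
(index `i : Fin t` denotes size `i+1`). -/
def Ptilde (ρ : ℝ) (t : ℕ) : Set (Fin t → ℝ) :=
  {q | (∀ i, q i ∈ Set.Icc (0 : ℝ) 1) ∧ (∑ i, q i) = 1 ∧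
    (∑ i, ((i.1 + 1 : ℕ) : ℝ) * q i) = ρ}

/-- `L̃(ρ,k,p) = ρ log(ρk) − log k − ρ + 1 − Σ p_i log(p_i d_i)`. -/
noncomputable def Ltilde (ρ k : ℝ) {t : ℕ} (q : Fin t → ℝ) : ℝ :=
  ρ * Real.log (ρ * k) - Real.log k - ρ + 1 -
    ∑ i, q i * Real.log (q i * dI (i.1 + 1))

/-- `L̃₀(ρ,k,t) = sup {L̃(ρ,k,p) : p ∈ P̃_{ρ,t}}`. -/
noncomputable def Ltilde0 (ρ k : ℝ) (t : ℕ) : ℝ :=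
  sSup {L : ℝ | ∃ q ∈ Ptilde ρ t, L = Ltilde ρ k q}

/-- `L̂₀(n,k,t) = L̃₀(n/k, k, t)`. -/
noncomputable def Lhat0 (n k : ℝ) (t : ℕ) : ℝ := Ltilde0 (n / k) k t

open scoped Classical in
/-- The probability that `G_{n,p}` lies in the set `A` of graphs. -/
noncomputable def gnpProb (n : ℕ) (p : ℝ) (A : Set (SimpleGraph (Fin n))) : ℝ :=
  ∑ G : SimpleGraph (Fin n), if G ∈ A then gnpWeight n p G else 0

/-- The chromatic number, as a natural number. -/
noncomputable def chrom {n : ℕ} (G : SimpleGraph (Fin n)) : ℕ := G.chromaticNumber.toNat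

/-- `μ_{α(n)}(n)` for `p = 1/2`. -/
noncomputable def muAl (n : ℕ) : ℝ := muR (1 / 2) (alphaNat 2 n) (n : ℝ)

/-- `ν(n) = (n / log n) / μ_{α(n)}(n)`. -/
noncomputable def nuAl (n : ℕ) : ℝ := ((n : ℝ) / Real.log n) / muAl n

lemma gnpWeight_half {n : ℕ} (G : SimpleGraph (Fin n)) :
    gnpWeight n (1 / 2) G = (1 / 2 : ℝ) ^ n.choose 2 := by
  classical
  have h : edgeCount G ≤ n.choose 2 := by
    have := G.card_edgeFinset_le_card_choose_two
    rw [Fintype.card_fin] at this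
    unfold edgeCount
    rwa [← SimpleGraph.coe_edgeFinset, Set.ncard_coe_finset]
  unfold gnpWeight
  rw [show (1 - 1 / 2 : ℝ) = 1 / 2 by norm_num, ← pow_add, Nat.add_sub_cancel' h]

lemma gnpProb_half_eq_ncard {n : ℕ} (A : Set (SimpleGraph (Fin n))) :
    gnpProb n (1 / 2) A = (A.ncard : ℝ) * (1 / 2 : ℝ) ^ n.choose 2 := by
  classical
  unfold gnpProb
  simp only [gnpWeight_half]
  rw [← Finset.sum_filter, Finset.sum_const, nsmul_eq_mul, ← Set.ncard_coe_finset]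
  simp

open scoped Classical in
lemma gnpProb_half_forall_isIndepSet {n : ℕ} {ι : Type*} (s : Finset ι)
    (c : ι → Finset (Fin n)) (hd : (s : Set ι).PairwiseDisjoint c) :
    gnpProb n (1 / 2) {G | ∀ j ∈ s, G.IsIndepSet (c j : Set (Fin n))} =
      (1 / 2 : ℝ) ^ ∑ j ∈ s, (c j).card.choose 2 := by
  set F : Finset (Sym2 (Fin n)) :=
    s.biUnion fun j => (c j).offDiag.image (Function.uncurry Sym2.mk) with hF
  have memF : ∀ u v : Fin n, s(u, v) ∈ F ↔ ∃ j ∈ s, u ∈ c j ∧ v ∈ c j ∧ u ≠ v := by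
    intro u v
    simp only [hF, Finset.mem_biUnion, Finset.mem_image, Finset.mem_offDiag, Prod.exists,
      Function.uncurry_apply_pair, Sym2.eq_iff]
    constructor
    · rintro ⟨j, hj, a, b, ⟨ha, hb, hab⟩, ⟨rfl, rfl⟩ | ⟨rfl, rfl⟩⟩
      · exact ⟨j, hj, ha, hb, hab⟩
      · exact ⟨j, hj, hb, ha, hab.symm⟩
    · rintro ⟨j, hj, ha, hb, hab⟩
      exact ⟨j, hj, u, v, ⟨ha, hb, hab⟩, Or.inl ⟨rfl, rfl⟩⟩
  have cardF : F.card = ∑ j ∈ s, (c j).card.choose 2 := by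
    rw [hF, Finset.card_biUnion]
    · exact Finset.sum_congr rfl fun j _ => Sym2.card_image_offDiag _
    · intro i hi j hj hij
      refine Finset.disjoint_left.2 fun e => ?_
      induction e with
      | _ u v =>
        intro h1 h2
        simp only [Finset.mem_image, Finset.mem_offDiag, Prod.exists,
          Function.uncurry_apply_pair, Sym2.eq_iff] at h1 h2
        have h1' : u ∈ c i := by
          obtain ⟨a, b, ⟨ha, hb, _⟩, ⟨rfl, rfl⟩ | ⟨rfl, rfl⟩⟩ := h1 <;> assumption
        have h2' : u ∈ c j := by
          obtain ⟨a, b, ⟨ha, hb, _⟩, ⟨rfl, rfl⟩ | ⟨rfl, rfl⟩⟩ := h2 <;> assumption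
        exact Finset.disjoint_left.1 (hd hi hj hij) h1' h2'
  have Fsub : F ⊆ (⊤ : SimpleGraph (Fin n)).edgeFinset := by
    intro e
    induction e with
    | _ u v =>
      intro h
      obtain ⟨j, -, -, -, hne⟩ := (memF u v).1 h
      simpa using hne
  have Ntop : (⊤ : SimpleGraph (Fin n)).edgeFinset.card = n.choose 2 := by
    rw [SimpleGraph.card_edgeFinset_top_eq_card_choose_two, Fintype.card_fin]
  have hcard :
      {G : SimpleGraph (Fin n) | ∀ j ∈ s, G.IsIndepSet (c j : Set (Fin n))}.ncard =
      ((⊤ : SimpleGraph (Fin n)).edgeFinset \ F).powerset.card := by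
    rw [Set.ncard_eq_toFinset_card']
    refine Finset.card_bij' (fun G _ => G.edgeFinset)
      (fun E _ => SimpleGraph.fromEdgeSet (E : Set (Sym2 (Fin n)))) ?_ ?_ ?_ ?_
    · intro G hG
      simp only [Set.mem_toFinset, Set.mem_ofPred_eq] at hG
      rw [Finset.mem_powerset]
      intro e
      induction e with
      | _ u v =>
        intro h
        rw [SimpleGraph.mem_edgeFinset, SimpleGraph.mem_edgeSet] at h
        rw [Finset.mem_sdiff, memF]
        refine ⟨by simpa using h.ne, ?_⟩
        rintro ⟨j, hj, hu, hv, hne⟩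
        exact hG j hj hu hv hne h
    · intro E hE
      rw [Finset.mem_powerset] at hE
      simp only [Set.mem_toFinset, Set.mem_ofPred_eq]
      intro j hj u hu v hv hne hadj
      rw [SimpleGraph.fromEdgeSet_adj] at hadj
      have := hE (Finset.mem_coe.1 hadj.1)
      rw [Finset.mem_sdiff, memF] at this
      exact this.2 ⟨j, hj, hu, hv, hne⟩
    · intro G _
      simp
    · intro E hE
      rw [Finset.mem_powerset] at hE
      ext e
      simp only [SimpleGraph.mem_edgeFinset, SimpleGraph.edgeSet_fromEdgeSet, Set.mem_sdiff,
        Finset.mem_coe, and_iff_left_iff_imp]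
      intro he
      have := (Finset.mem_sdiff.1 (hE he)).1
      simpa using this
  rw [gnpProb_half_eq_ncard, hcard, Finset.card_powerset, Finset.card_sdiff_of_subset Fsub, Ntop,
    cardF]
  have hle : ∑ j ∈ s, (c j).card.choose 2 ≤ n.choose 2 := by
    rw [← cardF, ← Ntop]; exact Finset.card_le_card Fsub
  obtain ⟨r, hr⟩ := Nat.exists_eq_add_of_le hle
  rw [hr, Nat.add_sub_cancel_left, pow_add]
  push_cast
  rw [mul_comm, mul_assoc, ← mul_pow]
  norm_num

lemma gnpProb_half_univ (n : ℕ) : gnpProb n (1 / 2) Set.univ = 1 := by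
  have h := gnpProb_half_forall_isIndepSet (n := n) (∅ : Finset ℕ) (fun _ => ∅) (by simp)
  simpa using h

lemma gnpProb_half_mono {n : ℕ} {A B : Set (SimpleGraph (Fin n))} (h : A ⊆ B) :
    gnpProb n (1 / 2) A ≤ gnpProb n (1 / 2) B := by
  rw [gnpProb_half_eq_ncard, gnpProb_half_eq_ncard]
  gcongr
  exact Set.toFinite B

lemma gnpProb_half_le_one {n : ℕ} (A : Set (SimpleGraph (Fin n))) :
    gnpProb n (1 / 2) A ≤ 1 :=
  (gnpProb_half_mono (Set.subset_univ A)).trans_eq (gnpProb_half_univ n)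

/-- Weighted first-moment bound. -/
lemma gnpProb_half_le_sum {n : ℕ} {ι : Type*} (A : Set (SimpleGraph (Fin n))) (J : Finset ι)
    (w : ι → ℝ) (B : ι → Set (SimpleGraph (Fin n))) (hw : ∀ j ∈ J, 0 ≤ w j)
    (h : ∀ G ∈ A, ∃ J' ⊆ J, (∀ j ∈ J', G ∈ B j) ∧ 1 ≤ ∑ j ∈ J', w j) :
    gnpProb n (1 / 2) A ≤ ∑ j ∈ J, w j * gnpProb n (1 / 2) (B j) := by
  classical
  unfold gnpProb
  simp only [gnpWeight_half, Finset.mul_sum]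
  rw [Finset.sum_comm]
  refine Finset.sum_le_sum fun G _ => ?_
  have hnn : ∀ j ∈ J, 0 ≤ w j * (if G ∈ B j then (1 / 2 : ℝ) ^ n.choose 2 else 0) := by
    intro j hj
    refine mul_nonneg (hw j hj) ?_
    split_ifs <;> positivity
  split_ifs with hG
  · obtain ⟨J', hJ', hB, h1⟩ := h G hG
    calc (1 / 2 : ℝ) ^ n.choose 2 ≤ (∑ j ∈ J', w j) * (1 / 2 : ℝ) ^ n.choose 2 :=
          le_mul_of_one_le_left (by positivity) h1
      _ = ∑ j ∈ J', w j * (if G ∈ B j then (1 / 2 : ℝ) ^ n.choose 2 else 0) := by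
          rw [Finset.sum_mul]
          refine Finset.sum_congr rfl fun j hj => ?_
          rw [if_pos (hB j hj)]
      _ ≤ _ := Finset.sum_le_sum_of_subset_of_nonneg hJ' fun j hj _ => hnn j hj
  · exact Finset.sum_nonneg hnn

lemma gnpProb_half_union_le {n : ℕ} (A B : Set (SimpleGraph (Fin n))) :
    gnpProb n (1 / 2) (A ∪ B) ≤ gnpProb n (1 / 2) A + gnpProb n (1 / 2) B := by
  have := gnpProb_half_le_sum (A ∪ B) (Finset.univ : Finset Bool) (fun _ => 1)
    (fun b => if b then A else B) (by simp) (by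
      rintro G (hG | hG)
      · exact ⟨{true}, by simp, by simpa using hG, by simp⟩
      · exact ⟨{false}, by simp, by simpa using hG, by simp⟩)
  simpa using this

/-- The ordered partitions of `U` into `k` (possibly empty) pairwise disjoint pieces. -/
def orderedPartitions {V : Type*} [Fintype V] [DecidableEq V] (k : ℕ) (U : Finset V) :
    Finset (Fin k → Finset V) :=
  Finset.univ.filter fun c =>
    (∀ i j, i ≠ j → Disjoint (c i) (c j)) ∧ Finset.univ.biUnion c = U

lemma mem_orderedPartitions {V : Type*} [Fintype V] [DecidableEq V] {k : ℕ} {U : Finset V}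
    {c : Fin k → Finset V} : c ∈ orderedPartitions k U ↔
      (∀ i j, i ≠ j → Disjoint (c i) (c j)) ∧ Finset.univ.biUnion c = U := by
  simp [orderedPartitions]

lemma sum_orderedPartitions_succ {V : Type*} [Fintype V] [DecidableEq V] (g : ℕ → ℝ) (k : ℕ)
    (U : Finset V) :
    ∑ c ∈ orderedPartitions (k + 1) U, ∏ j, g (c j).card =
      ∑ A ∈ U.powerset, g A.card * ∑ c ∈ orderedPartitions k (U \ A), ∏ j, g (c j).card := by
  simp only [Finset.mul_sum]
  rw [Finset.sum_sigma']
  refine Finset.sum_bij' (fun c _ => ⟨c 0, Fin.tail c⟩) (fun p _ => Fin.cons p.1 p.2)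
    ?_ ?_ ?_ ?_ ?_
  · intro c hc
    rw [mem_orderedPartitions] at hc
    obtain ⟨hd, hU⟩ := hc
    rw [Finset.mem_sigma, Finset.mem_powerset, mem_orderedPartitions]
    refine ⟨?_, ?_, ?_⟩
    · rw [← hU]
      exact Finset.subset_biUnion_of_mem c (Finset.mem_univ 0)
    · intro i j hij
      exact hd _ _ (by simpa using hij)
    · ext v
      have hv : v ∈ U ↔ ∃ i, v ∈ c i := by rw [← hU]; simp
      rw [Finset.mem_sdiff, hv, Fin.exists_fin_succ]
      simp only [Finset.mem_biUnion, Finset.mem_univ, true_and, Fin.tail]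
      constructor
      · rintro ⟨i, hi⟩
        exact ⟨Or.inr ⟨i, hi⟩, fun h0 =>
          Finset.disjoint_left.1 (hd 0 i.succ (Fin.succ_ne_zero i).symm) h0 hi⟩
      · rintro ⟨h0 | h0, h1⟩
        · exact absurd h0 h1
        · exact h0
  · rintro ⟨A, c⟩ hp
    rw [Finset.mem_sigma, Finset.mem_powerset, mem_orderedPartitions] at hp
    obtain ⟨hA, hd, hU⟩ := hp
    simp only at hA hd hU
    have hAd : ∀ j, Disjoint A (c j) := by
      intro j
      have : c j ⊆ U \ A := by
        rw [← hU]; exact Finset.subset_biUnion_of_mem c (Finset.mem_univ j)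
      exact Finset.disjoint_of_subset_right this Finset.disjoint_sdiff
    rw [mem_orderedPartitions]
    refine ⟨?_, ?_⟩
    · intro i j
      refine Fin.cases ?_ (fun i => ?_) i <;> refine Fin.cases ?_ (fun j => ?_) j
      · intro h; exact absurd rfl h
      · intro _; simpa using hAd j
      · intro _; simpa using (hAd i).symm
      · intro h; simpa using hd i j (by rintro rfl; exact h rfl)
    · ext v
      have hv : v ∈ U \ A ↔ ∃ i, v ∈ c i := by rw [← hU]; simp
      rw [Finset.mem_sdiff] at hv
      simp only [Finset.mem_biUnion, Finset.mem_univ, true_and]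
      rw [Fin.exists_fin_succ]
      simp only [Fin.cons_zero, Fin.cons_succ]
      rw [← hv]
      constructor
      · rintro (h | h)
        · exact hA h
        · exact h.1
      · intro h
        by_cases hvA : v ∈ A
        · exact Or.inl hvA
        · exact Or.inr ⟨h, hvA⟩
  · intro c _
    simp
  · rintro ⟨A, c⟩ _
    simp
  · intro c _
    rw [Fin.prod_univ_succ]
    rfl

lemma sum_orderedPartitions_le {V : Type*} [Fintype V] [DecidableEq V] (g : ℕ → ℝ)
    (hg : ∀ i, 0 ≤ g i) {x : ℝ} (hx : 0 < x) (N k : ℕ) (U : Finset V) (hU : U.card ≤ N) :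
    ∑ c ∈ orderedPartitions k U, ∏ j, g (c j).card ≤
      U.card.factorial * (x ^ U.card)⁻¹ *
        (∑ i ∈ Finset.range (N + 1), g i * x ^ i / i.factorial) ^ k := by
  set T : ℝ := ∑ i ∈ Finset.range (N + 1), g i * x ^ i / i.factorial with hT
  have hT0 : 0 ≤ T := Finset.sum_nonneg fun i _ => by have := hg i; positivity
  induction k generalizing U with
  | zero =>
    rcases U.eq_empty_or_nonempty with rfl | hne
    · have : (orderedPartitions 0 (∅ : Finset V)).card ≤ 1 := by
        rw [Finset.card_le_one]
        intro a _ b _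
        exact Subsingleton.elim a b
      simpa using this
    · have : orderedPartitions 0 U = ∅ := by
        rw [Finset.eq_empty_iff_forall_notMem]
        intro c hc
        have h := (mem_orderedPartitions.1 hc).2
        simp at h
        exact hne.ne_empty h.symm
      rw [this]
      simp only [Finset.sum_empty, pow_zero, mul_one]
      positivity
  | succ k ih =>
    rw [sum_orderedPartitions_succ]
    calc _ ≤ ∑ A ∈ U.powerset, g A.card *
          ((U.card - A.card).factorial * (x ^ (U.card - A.card))⁻¹ * T ^ k) := by
          refine Finset.sum_le_sum fun A hA => ?_
          rw [Finset.mem_powerset] at hA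
          refine mul_le_mul_of_nonneg_left ?_ (hg _)
          have := ih (U \ A) ((Finset.card_le_card Finset.sdiff_subset).trans hU)
          rwa [Finset.card_sdiff_of_subset hA] at this
      _ = ∑ i ∈ Finset.range (U.card + 1), (U.card.choose i : ℝ) *
          (g i * ((U.card - i).factorial * (x ^ (U.card - i))⁻¹ * T ^ k)) := by
          rw [Finset.sum_powerset_apply_card (fun i => g i *
            ((U.card - i).factorial * (x ^ (U.card - i))⁻¹ * T ^ k))]
          simp only [nsmul_eq_mul]
      _ = U.card.factorial * (x ^ U.card)⁻¹ * T ^ k *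
          ∑ i ∈ Finset.range (U.card + 1), g i * x ^ i / i.factorial := by
          rw [Finset.mul_sum]
          refine Finset.sum_congr rfl fun i hi => ?_
          have hi' : i ≤ U.card := Nat.lt_succ_iff.1 (Finset.mem_range.1 hi)
          rw [Nat.cast_choose ℝ hi']
          have hxp : x ^ U.card = x ^ i * x ^ (U.card - i) := by
            rw [← pow_add, Nat.add_sub_cancel' hi']
          rw [hxp]
          have h1 : ((U.card - i).factorial : ℝ) ≠ 0 := by positivity
          field_simp
      _ ≤ U.card.factorial * (x ^ U.card)⁻¹ * T ^ k * T := by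
          refine mul_le_mul_of_nonneg_left ?_ (by positivity)
          rw [hT]
          refine Finset.sum_le_sum_of_subset_of_nonneg ?_ fun i _ _ => by
            have := hg i; positivity
          intro i hi
          rw [Finset.mem_range] at hi ⊢
          omega
      _ = _ := by rw [pow_succ]; ring

/-- Exponential-formula bound for the existence of a weighted partition into independent sets. -/
lemma gnpProb_half_exists_partition_le {n : ℕ} (A : Set (SimpleGraph (Fin n))) (h : ℕ → ℝ)
    (hh : ∀ i, 0 ≤ h i) {W x : ℝ} (hW : 0 ≤ W) (hx : 0 < x)
    (hA : ∀ G ∈ A, ∃ k ≤ n, ∃ c ∈ orderedPartitions k (Finset.univ : Finset (Fin n)),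
      Function.Injective c ∧ (∀ j, G.IsIndepSet (c j : Set (Fin n))) ∧
      1 ≤ W * ∏ j, h (c j).card) :
    gnpProb n (1 / 2) A ≤ W * n.factorial * (x ^ n)⁻¹ *
      Real.exp (∑ i ∈ Finset.range (n + 1), h i * (1 / 2) ^ i.choose 2 * x ^ i / i.factorial) := by
  classical
  set g : ℕ → ℝ := fun i => h i * (1 / 2) ^ i.choose 2 with hg
  have hg0 : ∀ i, 0 ≤ g i := fun i => mul_nonneg (hh i) (by positivity)
  set T : ℝ := ∑ i ∈ Finset.range (n + 1), g i * x ^ i / i.factorial with hT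
  have hT0 : 0 ≤ T := Finset.sum_nonneg fun i _ => by have := hg0 i; positivity
  have key := gnpProb_half_le_sum A
    ((Finset.range (n + 1)).sigma fun k => orderedPartitions k (Finset.univ : Finset (Fin n)))
    (fun p => W * (p.1.factorial : ℝ)⁻¹ * ∏ j, h (p.2 j).card)
    (fun p => {G | ∀ j ∈ Finset.univ, G.IsIndepSet (p.2 j : Set (Fin n))})
    (fun p _ => mul_nonneg (by positivity) (Finset.prod_nonneg fun j _ => hh _)) (by
      intro G hG
      obtain ⟨k, hk, c, hc, hinj, hind, h1⟩ := hA G hG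
      have hinj' : Function.Injective fun σ : Equiv.Perm (Fin k) =>
          (⟨k, c ∘ σ⟩ : Σ k, Fin k → Finset (Fin n)) := by
        intro σ τ hst
        simp only [Sigma.mk.injEq, heq_eq_eq, true_and] at hst
        ext j
        exact congrArg Fin.val (hinj (congrFun hst j))
      refine ⟨Finset.univ.image fun σ : Equiv.Perm (Fin k) =>
        (⟨k, c ∘ σ⟩ : Σ k, Fin k → Finset (Fin n)), ?_, ?_, ?_⟩
      · intro p hp
        obtain ⟨σ, -, rfl⟩ := Finset.mem_image.1 hp
        rw [Finset.mem_sigma, Finset.mem_range, mem_orderedPartitions]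
        rw [mem_orderedPartitions] at hc
        refine ⟨by simpa using Nat.lt_succ_of_le hk, fun i j hij => hc.1 _ _ (by simpa using hij),
          ?_⟩
        rw [← hc.2]
        ext v
        simp only [Finset.mem_biUnion, Finset.mem_univ, true_and, Function.comp]
        exact σ.exists_congr_left.trans (by simp)
      · intro p hp
        obtain ⟨σ, -, rfl⟩ := Finset.mem_image.1 hp
        intro j _
        exact hind _
      · rw [Finset.sum_image fun a _ b _ hab => hinj' hab]
        have : ∀ σ : Equiv.Perm (Fin k), ∏ j, h ((c ∘ σ) j).card = ∏ j, h (c j).card :=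
          fun σ => Equiv.prod_comp σ fun j => h (c j).card
        simp only [this]
        rw [Finset.sum_const, Finset.card_univ, Fintype.card_perm, Fintype.card_fin, nsmul_eq_mul]
        have hk0 : (k.factorial : ℝ) ≠ 0 := by positivity
        calc (1 : ℝ) ≤ W * ∏ j, h (c j).card := h1
          _ = _ := by field_simp)
  refine key.trans ?_
  rw [Finset.sum_sigma]
  calc _ = ∑ k ∈ Finset.range (n + 1), W * (k.factorial : ℝ)⁻¹ *
        ∑ c ∈ orderedPartitions k (Finset.univ : Finset (Fin n)), ∏ j, g (c j).card := by
        refine Finset.sum_congr rfl fun k _ => ?_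
        rw [Finset.mul_sum]
        refine Finset.sum_congr rfl fun c hc => ?_
        rw [gnpProb_half_forall_isIndepSet]
        · simp only [hg, Finset.prod_mul_distrib, Finset.prod_pow_eq_pow_sum]
          ring
        · intro i _ j _ hij
          exact (mem_orderedPartitions.1 hc).1 i j hij
    _ ≤ ∑ k ∈ Finset.range (n + 1), W * (k.factorial : ℝ)⁻¹ *
        (n.factorial * (x ^ n)⁻¹ * T ^ k) := by
        refine Finset.sum_le_sum fun k _ => mul_le_mul_of_nonneg_left ?_ (by positivity)
        have := sum_orderedPartitions_le g hg0 hx n k (Finset.univ : Finset (Fin n)) (by simp)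
        simpa using this
    _ = W * n.factorial * (x ^ n)⁻¹ * ∑ k ∈ Finset.range (n + 1), T ^ k / k.factorial := by
        rw [Finset.mul_sum]
        refine Finset.sum_congr rfl fun k _ => ?_
        ring
    _ ≤ W * n.factorial * (x ^ n)⁻¹ * Real.exp T := by
        refine mul_le_mul_of_nonneg_left (Real.sum_le_exp_of_nonneg hT0 _) (by positivity)

lemma gnpProb_half_exists_isIndepSet_le (n a : ℕ) :
    gnpProb n (1 / 2) {G | ∃ S : Finset (Fin n), S.card = a ∧ G.IsIndepSet (S : Set (Fin n))} ≤
      n.choose a * (1 / 2 : ℝ) ^ a.choose 2 := by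
  classical
  have key := gnpProb_half_le_sum
    {G | ∃ S : Finset (Fin n), S.card = a ∧ G.IsIndepSet (S : Set (Fin n))}
    (Finset.powersetCard a (Finset.univ : Finset (Fin n))) (fun _ => 1)
    (fun S => {G | ∀ j ∈ ({()} : Finset Unit), G.IsIndepSet (S : Set (Fin n))}) (by simp) (by
      rintro G ⟨S, hS, hG⟩
      exact ⟨{S}, by simp [hS], by simpa using hG, by simp⟩)
  refine key.trans (le_of_eq ?_)
  have : ∀ S ∈ Finset.powersetCard a (Finset.univ : Finset (Fin n)),
      1 * gnpProb n (1 / 2) {G | ∀ j ∈ ({()} : Finset Unit), G.IsIndepSet (S : Set (Fin n))} =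
        (1 / 2 : ℝ) ^ a.choose 2 := by
    intro S hS
    rw [gnpProb_half_forall_isIndepSet _ (fun _ => S) (by simp), one_mul]
    simp [(Finset.mem_powersetCard.1 hS).2]
  rw [Finset.sum_congr rfl this, Finset.sum_const, Finset.card_powersetCard, Finset.card_fin,
    nsmul_eq_mul]

/-- Chernoff-type bound for the size of a family of disjoint independent `a`-sets. -/
lemma gnpProb_half_exists_disjoint_family_le (n a : ℕ) {θ : ℝ} (hθ : 0 < θ) (m : ℝ) :
    gnpProb n (1 / 2) {G | ∃ D : Finset (Finset (Fin n)), (∀ S ∈ D, S.card = a) ∧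
        (D : Set (Finset (Fin n))).PairwiseDisjoint id ∧
        (∀ S ∈ D, G.IsIndepSet (S : Set (Fin n))) ∧ m ≤ D.card} ≤
      (1 + θ) ^ (-m) * Real.exp (θ * (n.choose a * (1 / 2 : ℝ) ^ a.choose 2)) := by
  classical
  set P := Finset.powersetCard a (Finset.univ : Finset (Fin n)) with hP
  have hθ1 : 0 < 1 + θ := by linarith
  have key := gnpProb_half_le_sum
    {G | ∃ D : Finset (Finset (Fin n)), (∀ S ∈ D, S.card = a) ∧
        (D : Set (Finset (Fin n))).PairwiseDisjoint id ∧
        (∀ S ∈ D, G.IsIndepSet (S : Set (Fin n))) ∧ m ≤ D.card}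
    (P.powerset.filter fun D : Finset (Finset (Fin n)) => (D : Set (Finset (Fin n))).PairwiseDisjoint id)
    (fun D : Finset (Finset (Fin n)) => (1 + θ) ^ (-m) * θ ^ D.card)
    (fun D => {G | ∀ S ∈ D, G.IsIndepSet ((id S : Finset (Fin n)) : Set (Fin n))})
    (fun D _ => by positivity) (by
      rintro G ⟨D, hDa, hDd, hDi, hm⟩
      refine ⟨D.powerset, ?_, ?_, ?_⟩
      · intro E hE
        rw [Finset.mem_powerset] at hE
        rw [Finset.mem_filter, Finset.mem_powerset]
        refine ⟨fun S hS => ?_, hDd.subset (by exact_mod_cast hE)⟩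
        simpa [hP] using hDa S (hE hS)
      · intro E hE S hS
        exact hDi S (Finset.mem_powerset.1 hE hS)
      · rw [← Finset.mul_sum]
        have h1 : ∑ E ∈ D.powerset, θ ^ E.card = (1 + θ) ^ D.card := by
          have := Finset.prod_one_add (f := fun _ : Finset (Fin n) => θ) D
          simpa using this.symm
        rw [h1, ← Real.rpow_natCast, ← Real.rpow_add hθ1]
        exact Real.one_le_rpow (by linarith) (by linarith))
  refine key.trans ?_
  calc _ = ∑ D ∈ P.powerset.filter fun D : Finset (Finset (Fin n)) => (D : Set (Finset (Fin n))).PairwiseDisjoint id,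
        (1 + θ) ^ (-m) * (θ * (1 / 2 : ℝ) ^ a.choose 2) ^ D.card := by
        refine Finset.sum_congr rfl fun D hD => ?_
        rw [Finset.mem_filter, Finset.mem_powerset] at hD
        rw [gnpProb_half_forall_isIndepSet D id hD.2]
        have : ∑ S ∈ D, (id S).card.choose 2 = a.choose 2 * D.card := by
          rw [Finset.sum_congr rfl fun S hS => by
            rw [id, (Finset.mem_powersetCard.1 (hD.1 hS)).2], Finset.sum_const, smul_eq_mul,
            mul_comm]
        rw [this, mul_pow, pow_mul]
        ring
    _ ≤ ∑ D ∈ P.powerset, (1 + θ) ^ (-m) * (θ * (1 / 2 : ℝ) ^ a.choose 2) ^ D.card :=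
        Finset.sum_le_sum_of_subset_of_nonneg (Finset.filter_subset _ _) fun _ _ _ => by positivity
    _ = (1 + θ) ^ (-m) * (1 + θ * (1 / 2 : ℝ) ^ a.choose 2) ^ n.choose a := by
        have := Finset.prod_one_add
          (f := fun _ : Finset (Fin n) => θ * (1 / 2 : ℝ) ^ a.choose 2) P
        rw [← Finset.mul_sum]
        simp only [Finset.prod_const] at this
        rw [← this, hP, Finset.card_powersetCard, Finset.card_fin]
    _ ≤ (1 + θ) ^ (-m) * Real.exp (θ * (1 / 2 : ℝ) ^ a.choose 2) ^ n.choose a := by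
        gcongr
        rw [add_comm]
        exact Real.add_one_le_exp _
    _ = _ := by
        rw [← Real.exp_nat_mul]
        congr 2
        ring

/-- The truncated partition function `∑_{i=1}^{t} x^i / d_i`. -/
noncomputable def partFun (t : ℕ) (x : ℝ) : ℝ := ∑ i : Fin t, x ^ (i.1 + 1) / dI (i.1 + 1)

lemma dI_pos (i : ℕ) : 0 < dI i := by unfold dI; positivity

/-- First-moment bound for the lower tail of the chromatic number: either there is an independent
set of size `t + 2`, or more than `m` disjoint ones of size `t + 1`, or few colour classes. -/
lemma one_sub_gnpProb_chrom_le (n t : ℕ) {u z x θ : ℝ} (hu : 0 < u) (hu1 : u ≤ 1) (hz : 0 < z)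
    (hz1 : z ≤ 1) (hx : 0 < x) (hθ : 0 < θ) (m k₀ : ℝ) :
    1 - gnpProb n (1 / 2) {G | k₀ ≤ (chrom G : ℝ)} ≤
      n.choose (t + 2) * (1 / 2 : ℝ) ^ (t + 2).choose 2 +
      (1 + θ) ^ (-m) * Real.exp (θ * (n.choose (t + 1) * (1 / 2 : ℝ) ^ (t + 1).choose 2)) +
      u ^ (-k₀) * z ^ (-m) * n.factorial * (x ^ n)⁻¹ *
        Real.exp (u * partFun t x + u * z * (x ^ (t + 1) / dI (t + 1))) := by
  classical
  set A₁ : Set (SimpleGraph (Fin n)) :=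
    {G | ∃ S : Finset (Fin n), S.card = t + 2 ∧ G.IsIndepSet (S : Set (Fin n))} with hA₁
  set A₂ : Set (SimpleGraph (Fin n)) :=
    {G | ∃ D : Finset (Finset (Fin n)), (∀ S ∈ D, S.card = t + 1) ∧
        (D : Set (Finset (Fin n))).PairwiseDisjoint id ∧
        (∀ S ∈ D, G.IsIndepSet (S : Set (Fin n))) ∧ m ≤ D.card} with hA₂
  set A : Set (SimpleGraph (Fin n)) := {G | k₀ ≤ (chrom G : ℝ)} with hA
  set A₃ : Set (SimpleGraph (Fin n)) := {G | G ∉ A ∧ G ∉ A₁ ∧ G ∉ A₂} with hA₃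
  have hcover : gnpProb n (1 / 2) Set.univ ≤ gnpProb n (1 / 2) A +
      (gnpProb n (1 / 2) A₁ + gnpProb n (1 / 2) A₂ + gnpProb n (1 / 2) A₃) := by
    have h1 : (Set.univ : Set (SimpleGraph (Fin n))) ⊆ A ∪ ((A₁ ∪ A₂) ∪ A₃) := by
      intro G _
      by_cases h : G ∈ A <;> by_cases h1 : G ∈ A₁ <;> by_cases h2 : G ∈ A₂ <;>
        simp [h, h1, h2, hA₃]
    have h2 := gnpProb_half_mono h1
    have h3 := gnpProb_half_union_le A ((A₁ ∪ A₂) ∪ A₃)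
    have h4 := gnpProb_half_union_le (A₁ ∪ A₂) A₃
    have h5 := gnpProb_half_union_le A₁ A₂
    linarith
  rw [gnpProb_half_univ] at hcover
  have hb1 := gnpProb_half_exists_isIndepSet_le n (t + 2)
  have hb2 := gnpProb_half_exists_disjoint_family_le n (t + 1) hθ m
  set h : ℕ → ℝ := fun i =>
    if i ∈ Finset.Icc 1 t then u else if i = t + 1 then u * z else 0 with hh
  have hh0 : ∀ i, 0 ≤ h i := by
    intro i
    simp only [hh]
    split_ifs <;> positivity
  have hb3 := gnpProb_half_exists_partition_le A₃ h hh0 (W := u ^ (-k₀) * z ^ (-m)) (x := x)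
    (by positivity) hx (by
      rintro G ⟨hGA, hG1, hG2⟩
      have hcol := G.colorable_chromaticNumber_of_fintype
      set k := G.chromaticNumber.toNat with hk
      have hkG : G.chromaticNumber = (k : ℕ∞) := by
        rw [hk, ENat.natCast_toNat]
        exact SimpleGraph.chromaticNumber_ne_top_iff_exists.2 ⟨n, by
          simpa using G.colorable_of_fintype⟩
      obtain ⟨C⟩ := hcol
      have hsurj : Function.Surjective C :=
        (SimpleGraph.chromaticNumber_eq_iff_forall_surjective ⟨C⟩).1 hkG C
      have hkn : k ≤ n := by
        simpa using Fintype.card_le_of_surjective _ hsurj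
      set c : Fin k → Finset (Fin n) := fun j => Finset.univ.filter fun v => C v = j with hc
      have hcne : ∀ j, (c j).Nonempty := by
        intro j
        obtain ⟨v, hv⟩ := hsurj j
        exact ⟨v, by simp [hc, hv]⟩
      have hdis : ∀ i j, i ≠ j → Disjoint (c i) (c j) := by
        intro i j hij
        rw [Finset.disjoint_left]
        intro v hi hj
        simp only [hc, Finset.mem_filter, Finset.mem_univ, true_and] at hi hj
        exact hij (hi.symm.trans hj)
      have hinj : Function.Injective c := by
        intro i j hij
        by_contra hne
        have := hdis i j hne
        rw [hij, disjoint_self, Finset.bot_eq_empty] at this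
        exact (hcne j).ne_empty this
      have hind : ∀ j, G.IsIndepSet (c j : Set (Fin n)) := by
        intro j v hv w hw _ hadj
        simp only [hc, Finset.coe_filter, Finset.mem_univ, true_and, Set.mem_ofPred_eq] at hv hw
        exact C.valid hadj (hv.trans hw.symm)
      have hcard : ∀ j, (c j).card ≤ t + 1 := by
        intro j
        by_contra hlt
        push Not at hlt
        obtain ⟨S, hS, hSc⟩ := Finset.exists_subset_card_eq (show t + 2 ≤ (c j).card by omega)
        exact hG1 ⟨S, hSc, (hind j).mono (by exact_mod_cast hS)⟩
      refine ⟨k, hkn, c, ?_, hinj, hind, ?_⟩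
      · rw [mem_orderedPartitions]
        refine ⟨hdis, ?_⟩
        ext v
        simp [hc]
      · set J : Finset (Fin k) := Finset.univ.filter fun j => (c j).card = t + 1 with hJ
        have hJm : (J.card : ℝ) < m := by
          by_contra hle
          push Not at hle
          refine hG2 ⟨J.image c, ?_, ?_, ?_, ?_⟩
          · intro S hS
            obtain ⟨j, hj, rfl⟩ := Finset.mem_image.1 hS
            exact (Finset.mem_filter.1 hj).2
          · intro S hS T hT hST
            obtain ⟨i, -, rfl⟩ := Finset.mem_image.1 hS
            obtain ⟨j, -, rfl⟩ := Finset.mem_image.1 hT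
            exact hdis i j fun hij => hST (by rw [hij])
          · intro S hS
            obtain ⟨j, hj, rfl⟩ := Finset.mem_image.1 hS
            exact hind j
          · rwa [Finset.card_image_of_injective _ hinj]
        have hkk : (k : ℝ) < k₀ := by
          have : ¬ k₀ ≤ (chrom G : ℝ) := hGA
          exact not_le.1 this
        have hprod : ∏ j, h (c j).card = u ^ k * z ^ J.card := by
          have : ∀ j ∈ Finset.univ, h (c j).card = u * if (c j).card = t + 1 then z else 1 := by
            intro j _
            have h1 : 1 ≤ (c j).card := (hcne j).card_pos
            have h2 := hcard j
            simp only [hh, Finset.mem_Icc]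
            by_cases he : (c j).card = t + 1
            · rw [if_neg (by omega), if_pos he, if_pos he]
            · rw [if_pos (by omega), if_neg he, mul_one]
          rw [Finset.prod_congr rfl this, Finset.prod_mul_distrib, Finset.prod_const,
            Finset.card_fin, Finset.prod_ite, Finset.prod_const, Finset.prod_const_one, mul_one]
        rw [hprod, ← Real.rpow_natCast u, ← Real.rpow_natCast z]
        calc (1 : ℝ) ≤ u ^ ((k : ℝ) - k₀) * z ^ ((J.card : ℝ) - m) :=
              one_le_mul_of_one_le_of_one_le
                (Real.one_le_rpow_of_pos_of_le_one_of_nonpos hu hu1 (by linarith))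
                (Real.one_le_rpow_of_pos_of_le_one_of_nonpos hz hz1 (by linarith))
          _ = _ := by
              rw [sub_eq_neg_add, sub_eq_neg_add, Real.rpow_add hu, Real.rpow_add hz]
              ring)
  have hsum : ∑ i ∈ Finset.range (n + 1), h i * (1 / 2 : ℝ) ^ i.choose 2 * x ^ i / i.factorial ≤
      u * partFun t x + u * z * (x ^ (t + 1) / dI (t + 1)) := by
    set F : ℕ → ℝ := fun i => h i * (1 / 2 : ℝ) ^ i.choose 2 * x ^ i / i.factorial with hF
    have hF0 : ∀ i, 0 ≤ F i := fun i => by have := hh0 i; simp only [hF]; positivity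
    have hF' : ∀ i, F i = h i * (x ^ i / dI i) := by
      intro i
      simp only [hF, dI, one_div, inv_pow]
      field_simp
    have hle : ∑ i ∈ Finset.range (n + 1), F i ≤ ∑ i ∈ Finset.range (t + 2), F i := by
      rw [← Finset.sum_filter_ne_zero]
      refine Finset.sum_le_sum_of_subset_of_nonneg (fun i hi => ?_) fun i _ _ => hF0 i
      by_contra hlt
      refine (Finset.mem_filter.1 hi).2 ?_
      rw [Finset.mem_range] at hlt
      simp only [hF, hh, Finset.mem_Icc]
      rw [if_neg (by omega), if_neg (by omega)]
      simp
    refine hle.trans (le_of_eq ?_)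
    rw [Finset.sum_range_succ, Finset.sum_range_succ', Finset.sum_range]
    have h0 : F 0 = 0 := by simp [hF, hh]
    have ht1 : F (t + 1) = u * z * (x ^ (t + 1) / dI (t + 1)) := by
      rw [hF']; simp [hh]
    rw [h0, ht1, add_zero, partFun, Finset.mul_sum]
    congr 1
    refine Finset.sum_congr rfl fun i _ => ?_
    have : h (i.1 + 1) = u := by
      have := i.2
      simp only [hh, Finset.mem_Icc]
      rw [if_pos (by omega)]
    rw [hF', this]
  have hb4 : u ^ (-k₀) * z ^ (-m) * n.factorial * (x ^ n)⁻¹ *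
      Real.exp (∑ i ∈ Finset.range (n + 1), h i * (1 / 2 : ℝ) ^ i.choose 2 * x ^ i / i.factorial)
      ≤ u ^ (-k₀) * z ^ (-m) * n.factorial * (x ^ n)⁻¹ *
        Real.exp (u * partFun t x + u * z * (x ^ (t + 1) / dI (t + 1))) := by
    gcongr
  linarith

lemma partFun_pos {t : ℕ} (ht : 0 < t) {x : ℝ} (hx : 0 < x) : 0 < partFun t x := by
  have : NeZero t := ⟨ht.ne'⟩
  exact Finset.sum_pos (fun i _ => div_pos (pow_pos hx _) (dI_pos _)) Finset.univ_nonempty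

/-- Mean of the Gibbs distribution `p_i ∝ x^i / d_i` on `{1, …, t}`. -/
noncomputable def gibbsMean (t : ℕ) (x : ℝ) : ℝ :=
  (∑ i : Fin t, ((i.1 + 1 : ℕ) : ℝ) * (x ^ (i.1 + 1) / dI (i.1 + 1))) / partFun t x

lemma neg_sum_mul_log_le {ρ x : ℝ} {t : ℕ} (ht : 0 < t) (hx : 0 < x) {q : Fin t → ℝ}
    (hq : q ∈ Ptilde ρ t) :
    -∑ i, q i * Real.log (q i * dI (i.1 + 1)) ≤ Real.log (partFun t x) - ρ * Real.log x := by
  obtain ⟨hq01, hq1, hqρ⟩ := hq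
  have hS := partFun_pos ht hx
  have hterm : ∀ i : Fin t, -(q i * Real.log (q i * dI (i.1 + 1))) ≤
      q i * Real.log (partFun t x) - (((i.1 + 1 : ℕ) : ℝ) * q i) * Real.log x +
        (x ^ (i.1 + 1) / dI (i.1 + 1) / partFun t x - q i) := by
    intro i
    have hd := dI_pos (i.1 + 1)
    have hy : 0 < x ^ (i.1 + 1) / dI (i.1 + 1) / partFun t x := by positivity
    rcases (hq01 i).1.eq_or_lt with h0 | hpos
    · rw [← h0]; simp only [zero_mul, mul_zero, neg_zero, sub_zero, zero_add]; exact hy.le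
    · have h1 := Real.log_le_sub_one_of_pos (div_pos hy hpos)
      have h2 := mul_le_mul_of_nonneg_left h1 hpos.le
      have h3 : q i * (x ^ (i.1 + 1) / dI (i.1 + 1) / partFun t x / q i - 1) =
          x ^ (i.1 + 1) / dI (i.1 + 1) / partFun t x - q i := by
        field_simp
      have hxp : x ^ (i.1 + 1) ≠ 0 := by positivity
      rw [h3, Real.log_div (by positivity) hpos.ne', Real.log_div (by positivity) hS.ne',
        Real.log_div hxp hd.ne', Real.log_pow] at h2
      rw [Real.log_mul hpos.ne' hd.ne']
      linarith
  have hsum := Finset.sum_le_sum fun i (_ : i ∈ Finset.univ) => hterm i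
  rw [Finset.sum_neg_distrib, Finset.sum_add_distrib, Finset.sum_sub_distrib,
    Finset.sum_sub_distrib, ← Finset.sum_mul, ← Finset.sum_mul, ← Finset.sum_div, hq1, hqρ] at hsum
  have : (∑ i : Fin t, x ^ (i.1 + 1) / dI (i.1 + 1)) / partFun t x = 1 := div_self hS.ne'
  rw [this] at hsum
  linarith

/-- Strong duality: the entropy maximum is attained at the Gibbs distribution of mean `ρ`. -/
lemma Ltilde0_eq_of_gibbsMean {ρ k x : ℝ} {t : ℕ} (ht : 0 < t) (hx : 0 < x)
    (hmean : gibbsMean t x = ρ) :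
    Ltilde0 ρ k t = ρ * Real.log (ρ * k) - Real.log k - ρ + 1 +
      (Real.log (partFun t x) - ρ * Real.log x) := by
  have hS := partFun_pos ht hx
  set q : Fin t → ℝ := fun i => x ^ (i.1 + 1) / dI (i.1 + 1) / partFun t x with hq
  have hq0 : ∀ i, 0 < q i := fun i => by have := dI_pos (i.1 + 1); simp only [hq]; positivity
  have hq1 : ∑ i, q i = 1 := by
    simp only [hq]
    rw [← Finset.sum_div]
    exact div_self hS.ne'
  have hqρ : ∑ i, ((i.1 + 1 : ℕ) : ℝ) * q i = ρ := by
    rw [← hmean, gibbsMean, Finset.sum_div]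
    exact Finset.sum_congr rfl fun i _ => by simp only [hq]; ring
  have hmem : q ∈ Ptilde ρ t := by
    refine ⟨fun i => ⟨(hq0 i).le, ?_⟩, hq1, hqρ⟩
    rw [← hq1]
    exact Finset.single_le_sum (fun j _ => (hq0 j).le) (Finset.mem_univ i)
  have hval : ∑ i, q i * Real.log (q i * dI (i.1 + 1)) =
      ρ * Real.log x - Real.log (partFun t x) := by
    have : ∀ i ∈ Finset.univ, q i * Real.log (q i * dI (i.1 + 1)) =
        ((i.1 + 1 : ℕ) : ℝ) * q i * Real.log x - q i * Real.log (partFun t x) := by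
      intro i _
      have hd := dI_pos (i.1 + 1)
      have h1 : q i * dI (i.1 + 1) = x ^ (i.1 + 1) / partFun t x := by
        simp only [hq]; field_simp
      have hxp : x ^ (i.1 + 1) ≠ 0 := by positivity
      rw [h1, Real.log_div hxp hS.ne', Real.log_pow]
      ring
    rw [Finset.sum_congr rfl this, Finset.sum_sub_distrib, ← Finset.sum_mul, ← Finset.sum_mul,
      hq1, hqρ, one_mul]
  refine IsGreatest.csSup_eq ⟨⟨q, hmem, ?_⟩, ?_⟩
  · rw [Ltilde, hval]; ring
  · rintro L ⟨q', hq', rfl⟩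
    have := neg_sum_mul_log_le ht hx hq'
    rw [Ltilde]
    linarith

lemma continuousOn_gibbsMean {t : ℕ} (ht : 0 < t) : ContinuousOn (gibbsMean t) (Set.Ioi 0) := by
  unfold gibbsMean
  refine ContinuousOn.div ?_ ?_ fun x hx => (partFun_pos ht hx).ne'
  · exact (continuous_finsetSum _ fun i _ => by fun_prop).continuousOn
  · unfold partFun
    exact (continuous_finsetSum _ fun i _ => by fun_prop).continuousOn

lemma exists_gibbsMean_eq {t : ℕ} (ht : 0 < t) {ρ x₁ x₂ : ℝ} (h₁ : 0 < x₁) (h₁₂ : x₁ ≤ x₂)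
    (hl : gibbsMean t x₁ ≤ ρ) (hr : ρ ≤ gibbsMean t x₂) :
    ∃ x ∈ Set.Icc x₁ x₂, gibbsMean t x = ρ :=
  intermediate_value_Icc h₁₂ ((continuousOn_gibbsMean ht).mono fun _ hy => h₁.trans_le hy.1)
    ⟨hl, hr⟩

lemma dI_succ (i : ℕ) : dI (i + 1) = dI i * (2 ^ i * (i + 1)) := by
  unfold dI
  rw [Nat.choose_succ_succ' i 1, Nat.choose_one_right, pow_add, Nat.factorial_succ]
  push_cast
  ring

lemma gibbsWeight_succ (x : ℝ) (i : ℕ) :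
    x ^ (i + 1) / dI (i + 1) * (2 ^ i * (i + 1)) = x ^ i / dI i * x := by
  have := dI_pos i
  rw [dI_succ]
  field_simp
  ring

lemma sub_le_gibbsMean (T : ℕ) {x r : ℝ} (hx : 0 < x) (hr0 : 0 ≤ r) (hr : r < 1)
    (h : 2 ^ T * ((T : ℝ) + 1) ≤ r * x) :
    (T + 1 : ℝ) - r / (1 - r) ≤ gibbsMean (T + 1) x := by
  set b : ℕ → ℝ := fun i => x ^ (i + 1) / dI (i + 1) with hb
  have hb0 : ∀ i, 0 < b i := fun i => div_pos (pow_pos hx _) (dI_pos _)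
  have hstep : ∀ i < T, b i ≤ r * b (i + 1) := by
    intro i hi
    have h1 := gibbsWeight_succ x (i + 1)
    have h2 : (2 : ℝ) ^ (i + 1) * ((i + 1 : ℕ) + 1) ≤ r * x := by
      refine le_trans ?_ h
      have : ((i + 1 : ℕ) : ℝ) ≤ T := by exact_mod_cast hi
      gcongr
      · norm_num
      · exact hi
    have h3 : b i * x ≤ (r * b (i + 1)) * x := by
      calc b i * x = b (i + 1) * (2 ^ (i + 1) * ((i + 1 : ℕ) + 1)) := h1.symm
        _ ≤ b (i + 1) * (r * x) := mul_le_mul_of_nonneg_left h2 (hb0 _).le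
        _ = _ := by ring
    exact le_of_mul_le_mul_right h3 hx
  have hS := partFun_pos (Nat.succ_pos T) hx
  have hSb : partFun (T + 1) x = ∑ i ∈ Finset.range (T + 1), b i := by
    rw [Finset.sum_range]; rfl
  set D := ∑ i ∈ Finset.range (T + 1), ((T : ℝ) - i) * b i with hD
  have hDr : D ≤ r * (D + partFun (T + 1) x) := by
    have h1 : D = ∑ i ∈ Finset.range T, ((T : ℝ) - i) * b i := by
      rw [hD, Finset.sum_range_succ]; simp
    have h2 : D + partFun (T + 1) x = ∑ i ∈ Finset.range T, ((T : ℝ) - i) * b (i + 1)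
        + (T + 1) * b 0 := by
      rw [hD, hSb, ← Finset.sum_add_distrib, Finset.sum_range_succ']
      congr 1
      · refine Finset.sum_congr rfl fun i _ => ?_
        push_cast; ring
      · push_cast; ring
    rw [h2, mul_add, Finset.mul_sum]
    nth_rewrite 1 [h1]
    have h3 : 0 ≤ r * ((T + 1) * b 0) := by have := hb0 0; positivity
    have h4 : ∑ i ∈ Finset.range T, ((T : ℝ) - i) * b i ≤
        ∑ i ∈ Finset.range T, r * (((T : ℝ) - i) * b (i + 1)) := by
      refine Finset.sum_le_sum fun i hi => ?_
      rw [Finset.mem_range] at hi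
      have : (0 : ℝ) ≤ T - i := sub_nonneg.2 (by exact_mod_cast hi.le)
      calc ((T : ℝ) - i) * b i ≤ (T - i) * (r * b (i + 1)) :=
            mul_le_mul_of_nonneg_left (hstep i hi) this
        _ = _ := by ring
    linarith
  have hmean : gibbsMean (T + 1) x = (T + 1 : ℝ) - D / partFun (T + 1) x := by
    have : ∑ i : Fin (T + 1), ((i.1 + 1 : ℕ) : ℝ) * (x ^ (i.1 + 1) / dI (i.1 + 1)) =
        (T + 1) * partFun (T + 1) x - D := by
      rw [hSb, hD, Finset.mul_sum, ← Finset.sum_sub_distrib, Finset.sum_range]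
      refine Finset.sum_congr rfl fun i _ => ?_
      simp only [hb]
      push_cast
      ring
    rw [gibbsMean, this]
    field_simp
  rw [hmean]
  have : D / partFun (T + 1) x ≤ r / (1 - r) := by
    rw [div_le_div_iff₀ hS (by linarith)]
    linarith
  linarith

lemma gibbsMean_le_add_one (T s : ℕ) (hs : 1 ≤ s) {x : ℝ} (hx : 0 < x)
    (h : x ≤ 2 ^ s * ((s : ℝ) + 1) / 2) : gibbsMean (T + 1) x ≤ s + 1 := by
  set b : ℕ → ℝ := fun i => x ^ (i + 1) / dI (i + 1) with hb
  have hb0 : ∀ i, 0 < b i := fun i => div_pos (pow_pos hx _) (dI_pos _)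
  have hstep : ∀ i, s ≤ i + 1 → b (i + 1) ≤ 1 / 2 * b i := by
    intro i hi
    have h1 := gibbsWeight_succ x (i + 1)
    set P : ℝ := 2 ^ (i + 1) * ((i + 1 : ℕ) + 1) with hP
    have hP0 : 0 < P := by positivity
    have h2 : x ≤ P / 2 := by
      refine h.trans ?_
      have : (s : ℝ) ≤ ((i + 1 : ℕ) : ℝ) := by exact_mod_cast hi
      rw [hP]
      gcongr
      norm_num
    have h3 : b (i + 1) * P ≤ (1 / 2 * b i) * P := by
      calc b (i + 1) * P = b i * x := h1
        _ ≤ b i * (P / 2) := mul_le_mul_of_nonneg_left h2 (hb0 _).le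
        _ = _ := by ring
    exact le_of_mul_le_mul_right h3 hP0
  have hS := partFun_pos (Nat.succ_pos T) hx
  have hSb : partFun (T + 1) x = ∑ i ∈ Finset.range (T + 1), b i := by
    rw [Finset.sum_range]; rfl
  set D := ∑ i ∈ Finset.range (T + 1), ((i + 1 - s : ℕ) : ℝ) * b i with hD
  have hDr : D ≤ 1 / 2 * (D + partFun (T + 1) x) := by
    have h1 : D = ∑ i ∈ Finset.range T, ((i + 2 - s : ℕ) : ℝ) * b (i + 1) := by
      rw [hD, Finset.sum_range_succ', Nat.zero_add, Nat.sub_eq_zero_of_le hs]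
      simp
    have h2 : ∑ i ∈ Finset.range T, ((i + 2 - s : ℕ) : ℝ) * b (i + 1) ≤
        ∑ i ∈ Finset.range T, 1 / 2 * (((i + 1 - s : ℕ) : ℝ) * b i + b i) := by
      refine Finset.sum_le_sum fun i _ => ?_
      by_cases hi : s ≤ i + 1
      · have h3 : i + 2 - s = (i + 1 - s) + 1 := by omega
        rw [h3]
        push_cast
        have := mul_le_mul_of_nonneg_left (hstep i hi)
          (show (0 : ℝ) ≤ ((i + 1 - s : ℕ) : ℝ) + 1 by positivity)
        linarith
      · have h3 : i + 2 - s = 0 := by omega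
        rw [h3]
        have := hb0 i
        simp only [Nat.cast_zero, zero_mul]
        positivity
    have h4 : ∑ i ∈ Finset.range T, 1 / 2 * (((i + 1 - s : ℕ) : ℝ) * b i + b i) ≤
        ∑ i ∈ Finset.range (T + 1), 1 / 2 * (((i + 1 - s : ℕ) : ℝ) * b i + b i) := by
      rw [Finset.sum_range_succ]
      have := hb0 T
      have : 0 ≤ 1 / 2 * (((T + 1 - s : ℕ) : ℝ) * b T + b T) := by positivity
      linarith
    rw [← Finset.mul_sum, ← Finset.mul_sum, Finset.sum_add_distrib, Finset.sum_add_distrib] at h4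
    rw [← Finset.mul_sum, Finset.sum_add_distrib] at h2
    rw [hSb]
    linarith
  have hnum : ∑ i : Fin (T + 1), ((i.1 + 1 : ℕ) : ℝ) * (x ^ (i.1 + 1) / dI (i.1 + 1)) ≤
      s * partFun (T + 1) x + D := by
    rw [hSb, hD, Finset.mul_sum, ← Finset.sum_add_distrib, Finset.sum_range]
    refine Finset.sum_le_sum fun i _ => ?_
    have h1 : ((i.1 + 1 : ℕ) : ℝ) ≤ s + ((i.1 + 1 - s : ℕ) : ℝ) := by
      exact_mod_cast (by omega : i.1 + 1 ≤ s + (i.1 + 1 - s))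
    have := mul_le_mul_of_nonneg_right h1 (hb0 i).le
    simp only [hb] at this ⊢
    linarith
  rw [gibbsMean, div_le_iff₀ hS]
  linarith

lemma factorial_le_exp_mul {n : ℕ} (hn : 1 ≤ n) :
    (n.factorial : ℝ) ≤ Real.exp 1 * n * Real.exp (n * Real.log n - n) := by
  obtain ⟨m, rfl⟩ : ∃ m, n = m + 1 := ⟨n - 1, by omega⟩
  have h := Stirling.stirlingSeq'_antitone (Nat.zero_le m)
  simp only [Function.comp, Nat.succ_eq_add_one, zero_add, Stirling.stirlingSeq_one] at h
  set N : ℝ := ((m + 1 : ℕ) : ℝ) with hN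
  have hN1 : 1 ≤ N := by rw [hN]; exact_mod_cast hn
  have hN0 : 0 < N := by linarith
  unfold Stirling.stirlingSeq at h
  rw [← hN, div_le_iff₀ (by positivity)] at h
  have hpow : (N / Real.exp 1) ^ (m + 1) = Real.exp (N * Real.log N - N) := by
    rw [← Real.exp_log (show 0 < N / Real.exp 1 by positivity), ← Real.exp_nat_mul,
      Real.log_div hN0.ne' (Real.exp_pos 1).ne', Real.log_exp, ← hN]
    congr 1
    ring
  have hsq : Real.exp 1 / √2 * √(2 * N) ≤ Real.exp 1 * N := by
    have h2 : √(2 * N) = √2 * √N := Real.sqrt_mul (by norm_num) N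
    have h3 : √N ≤ N := by
      rw [Real.sqrt_le_left hN0.le]
      nlinarith
    have h4 : (√2 : ℝ) ≠ 0 := by positivity
    calc Real.exp 1 / √2 * √(2 * N) = Real.exp 1 * √N := by rw [h2]; field_simp
      _ ≤ _ := by gcongr
  rw [hpow] at h
  calc ((m + 1).factorial : ℝ) ≤ (Real.exp 1 / √2) * (√(2 * N) * Real.exp (N * Real.log N - N)) := h
    _ = (Real.exp 1 / √2 * √(2 * N)) * Real.exp (N * Real.log N - N) := by ring
    _ ≤ _ := by gcongr

lemma log_partFun_div_eq {n t : ℕ} (ht : 0 < t) {k x : ℝ} (hk : 0 < k) (hx : 0 < x)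
    (hmean : gibbsMean t x = n / k) (h0 : Lhat0 n k t = 0) :
    Real.log (partFun t x / k) = n / k * (Real.log x - Real.log n + 1) - 1 := by
  have hS := partFun_pos ht hx
  rw [Lhat0, Ltilde0_eq_of_gibbsMean ht hx hmean, div_mul_cancel₀ _ hk.ne'] at h0
  rw [Real.log_div hS.ne' hk.ne']
  linarith

lemma colouring_term_le {n t : ℕ} (hn : 1 ≤ n) (ht : 0 < t) {k x : ℝ} (hk : 0 < k) (hx : 0 < x)
    (hmean : gibbsMean t x = n / k) (h0 : Lhat0 n k t = 0) {z : ℝ} (hz : 0 < z) (m Δ E : ℝ) :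
    (k / partFun t x) ^ (-(k - Δ)) * z ^ (-m) * n.factorial * (x ^ n)⁻¹ *
        Real.exp (k / partFun t x * partFun t x + E) ≤
      Real.exp 1 * n * Real.exp (-Real.log (partFun t x / k) * Δ - m * Real.log z + E) := by
  have hS := partFun_pos ht hx
  have hn0 : (0 : ℝ) < n := by exact_mod_cast hn
  have hlog := log_partFun_div_eq ht hk hx hmean h0
  set Λ := Real.log (partFun t x / k) with hΛ
  have hu : k / partFun t x = Real.exp (-Λ) := by
    rw [Real.exp_neg, hΛ, Real.exp_log (by positivity), inv_div]
  have hxn : (x ^ n)⁻¹ = Real.exp (-(n * Real.log x)) := by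
    rw [Real.exp_neg, Real.exp_nat_mul, Real.exp_log hx]
  rw [div_mul_cancel₀ _ hS.ne', hxn, hu, ← Real.exp_mul, Real.rpow_def_of_pos hz]
  have hkΛ : k * Λ = n * (Real.log x - Real.log n + 1) - k := by
    rw [hlog]; field_simp
  calc _ ≤ Real.exp (-Λ * -(k - Δ)) * Real.exp (Real.log z * -m) *
        (Real.exp 1 * n * Real.exp (n * Real.log n - n)) * Real.exp (-(n * Real.log x)) *
        Real.exp (k + E) := by
        gcongr
        exact factorial_le_exp_mul hn
    _ = Real.exp 1 * n * (Real.exp (-Λ * -(k - Δ)) * Real.exp (Real.log z * -m) *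
        Real.exp (n * Real.log n - n) * Real.exp (-(n * Real.log x)) * Real.exp (k + E)) := by ring
    _ = _ := by
        simp only [← Real.exp_add]
        congr 2
        linarith

lemma muR_half_eq (n a : ℕ) : muR (1 / 2) a n = n.choose a * (1 / 2 : ℝ) ^ a.choose 2 := by
  rw [muR, Nat.cast_choose_eq_descPochhammer_div, descPochhammer_eval_eq_prod_range]

lemma choose_succ_mul_le (n a : ℕ) :
    n.choose (a + 1) * (1 / 2 : ℝ) ^ (a + 1).choose 2 ≤
      muR (1 / 2) a n * (n * (1 / 2 : ℝ) ^ a / (a + 1)) := by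
  rw [muR_half_eq, Nat.choose_succ_succ' a 1, Nat.choose_one_right, pow_add]
  have h : (n.choose (a + 1) : ℝ) * (a + 1) ≤ n.choose a * n := by
    have h1 := Nat.choose_succ_right_eq n a
    have h2 : n.choose (a + 1) * (a + 1) ≤ n.choose a * n := by
      rw [h1]; exact Nat.mul_le_mul_left _ (Nat.sub_le _ _)
    exact_mod_cast h2
  have h3 : (n.choose (a + 1) : ℝ) ≤ n.choose a * n / (a + 1) := by
    rw [le_div_iff₀ (by positivity)]; exact h
  calc _ ≤ (n.choose a * n / (a + 1) : ℝ) * ((1 / 2) ^ a * (1 / 2) ^ a.choose 2) := by gcongr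
    _ = _ := by ring

lemma alpha0_mul_log_two {y : ℝ} (hy : 0 < Real.log y) :
    alpha0 2 y * Real.log 2 = 2 * Real.log y - 2 * Real.log (Real.log y) +
      (2 - 2 * Real.log 2 + 2 * Real.log (Real.log 2)) + Real.log 2 := by
  have h2 : 0 < Real.log 2 := Real.log_pos (by norm_num)
  unfold alpha0 Real.logb
  rw [Real.log_div hy.ne' h2.ne', Real.log_div (Real.exp_pos 1).ne' (by norm_num), Real.log_exp]
  field_simp
  ring

lemma eventually_alpha0_bounds (M : ℝ) : ∀ᶠ n : ℕ in atTop,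
    M ≤ Real.log n ∧ Real.log n / 2 + M ≤ Real.log n - Real.log (Real.log n) ∧
      Real.log n + M ≤ alpha0 2 n ∧ alpha0 2 n ≤ 3 * Real.log n := by
  have hlog : Tendsto (fun n : ℕ => Real.log n) atTop atTop :=
    Real.tendsto_log_atTop.comp tendsto_natCast_atTop_atTop
  set κ := (2 - 2 * Real.log 2 + 2 * Real.log (Real.log 2)) + Real.log 2 with hκ
  have hll : ∀ᶠ n : ℕ in atTop, Real.log (Real.log n) ≤ 1 / 100 * Real.log n := by
    have h := (Real.isLittleO_log_id_atTop.bound (show (0 : ℝ) < 1 / 100 by norm_num))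
    filter_upwards [hlog.eventually h, hlog.eventually_ge_atTop 1] with n h1 h2
    simp only [id, Real.norm_eq_abs] at h1
    rw [abs_of_nonneg (by linarith : (0 : ℝ) ≤ Real.log n)] at h1
    exact (le_abs_self _).trans h1
  filter_upwards [hll, hlog.eventually_ge_atTop (1 + 100 * (|M| + |κ|))] with n h1 h2
  have hM := le_abs_self M
  have hM0 := abs_nonneg M
  have hκ1 := le_abs_self κ
  have hκ2 := neg_abs_le κ
  have hκ0 := abs_nonneg κ
  set L := Real.log n with hL
  have hL1 : 1 ≤ L := by linarith
  have hll0 : 0 ≤ Real.log L := Real.log_nonneg hL1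
  have hid := alpha0_mul_log_two (y := n) (by rw [← hL]; linarith)
  rw [← hL] at hid
  have hid' : alpha0 2 n * Real.log 2 = 2 * L - 2 * Real.log L + κ := by rw [hid, hκ]; ring
  have l1 := Real.log_two_gt_d9
  have l2 := Real.log_two_lt_d9
  refine ⟨by linarith, by linarith, ?_, ?_⟩
  · by_contra hlt
    push Not at hlt
    have h3 : alpha0 2 n * Real.log 2 ≤ (L + |M|) * Real.log 2 :=
      mul_le_mul_of_nonneg_right (by linarith) (by linarith)
    have h4 : (L + |M|) * Real.log 2 ≤ (L + |M|) * 1 :=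
      mul_le_mul_of_nonneg_left (by linarith) (by linarith)
    linarith
  · by_contra hlt
    push Not at hlt
    have h3 : 3 * L * Real.log 2 ≤ alpha0 2 n * Real.log 2 :=
      mul_le_mul_of_nonneg_right hlt.le (by linarith)
    have h4 : 3 * L * 0.69 ≤ 3 * L * Real.log 2 :=
      mul_le_mul_of_nonneg_left (by linarith) (by linarith)
    linarith

lemma alphaNat_bounds {y : ℝ} (h : 0 ≤ alpha0 2 y) :
    (alphaNat 2 y : ℝ) ≤ alpha0 2 y ∧ alpha0 2 y < alphaNat 2 y + 1 := by
  have : alphaNat 2 y = ⌊alpha0 2 y⌋₊ := Int.floor_toNat _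
  rw [this]
  exact ⟨Nat.floor_le h, Nat.lt_floor_add_one _⟩

lemma chernoff_factor_le {δ μ : ℝ} (hδ : 0 < δ) (hδ1 : δ ≤ 1) (hμ : 0 ≤ μ) :
    (1 + δ) ^ (-((1 + δ) * μ)) * Real.exp (δ * μ) ≤ Real.exp (-(μ * δ ^ 2 / 3)) := by
  have h1 := Real.le_log_one_add_of_nonneg hδ.le
  rw [Real.rpow_def_of_pos (by linarith), ← Real.exp_add]
  rw [Real.exp_le_exp]
  have h2 : δ + δ ^ 2 / 3 ≤ (1 + δ) * Real.log (1 + δ) := by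
    calc δ + δ ^ 2 / 3 ≤ (1 + δ) * (2 * δ / (δ + 2)) := by
          rw [← mul_div_assoc, le_div_iff₀ (by linarith)]
          nlinarith [mul_nonneg (sq_nonneg δ) (sub_nonneg.2 hδ1)]
      _ ≤ _ := by gcongr
  have h3 := mul_le_mul_of_nonneg_right h2 hμ
  linarith

lemma exponent_le_neg {L μ l Λ Y c b A Δ : ℝ} (hL : 1 ≤ L) (hμ : 0 ≤ μ) (hl : 0 < l) (hlL : l ≤ L)
    (hY : 0 < Y) (hc : 0 ≤ c) (hcL : 2 * c ≤ L) (hb : 0 ≤ b) (hA : A = 2 * (c + 2 * b + 3))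
    (hΛ : Y * (1 - c / L) ≤ Λ) (hΔ : Δ = (1 + A / l) * μ * l / Y) :
    -Λ * Δ + (1 + 1 / L) * μ * (b + l) + μ ≤ -μ := by
  have hΔ' : Δ = μ * (l + A) / Y := by rw [hΔ]; field_simp
  have hA0 : 0 ≤ A := by rw [hA]; positivity
  have h1 : μ * (l + A) * (1 - c / L) ≤ Λ * Δ := by
    have : 0 ≤ Δ := by rw [hΔ']; positivity
    calc μ * (l + A) * (1 - c / L) = Y * (1 - c / L) * Δ := by rw [hΔ']; field_simp
      _ ≤ Λ * Δ := mul_le_mul_of_nonneg_right hΛ this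
  have hL0 : 0 < L := by linarith
  set d := 1 / L with hd
  have hd0 : 0 < d := by positivity
  have hd1 : d ≤ 1 := by rw [hd, div_le_one hL0]; exact hL
  have hcd : c / L = c * d := by rw [hd]; ring
  have hcd2 : c * d ≤ 1 / 2 := by rw [← hcd, div_le_iff₀ hL0]; linarith
  have hld : l * d ≤ 1 := by rw [hd, mul_one_div, div_le_one hL0]; exact hlL
  rw [hcd] at h1
  have h2 : 0 ≤ (l + A) * (1 - c * d) - (1 + d) * (b + l) - 2 := by
    have e1 : A * (c * d) ≤ A * (1 / 2) := mul_le_mul_of_nonneg_left hcd2 hA0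
    have e2 : c * (l * d) ≤ c * 1 := mul_le_mul_of_nonneg_left hld hc
    have e3 : d * b ≤ 1 * b := mul_le_mul_of_nonneg_right hd1 hb
    nlinarith
  have h3 := mul_nonneg hμ h2
  linarith

lemma exists_saddle {T s : ℕ} {r ρ : ℝ} (hs : 1 ≤ s) (hsT : s ≤ T) (hr : 0 < r) (hr1 : r < 1)
    (h₁ : (s + 1 : ℝ) ≤ ρ) (h₂ : ρ ≤ (T + 1 : ℝ) - r / (1 - r)) :
    ∃ x : ℝ, 0 < x ∧ gibbsMean (T + 1) x = ρ ∧ 2 ^ s * ((s : ℝ) + 1) / 2 ≤ x ∧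
      x ^ (T + 2) / dI (T + 2) ≤ 1 / (2 * r) * partFun (T + 1) x := by
  have hle : 2 ^ s * ((s : ℝ) + 1) / 2 ≤ 2 ^ T * ((T : ℝ) + 1) / r := by
    have hsT' : (s : ℝ) ≤ T := by exact_mod_cast hsT
    have : (2 : ℝ) ^ s ≤ 2 ^ T := pow_le_pow_right₀ (by norm_num) hsT
    gcongr
    linarith
  have hx₁ : 0 < 2 ^ s * ((s : ℝ) + 1) / 2 := by positivity
  have hx₂ : 0 < 2 ^ T * ((T : ℝ) + 1) / r := by positivity
  obtain ⟨x, ⟨hxl, hxr⟩, hx⟩ := exists_gibbsMean_eq (Nat.succ_pos T) hx₁ hle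
    ((gibbsMean_le_add_one T s hs hx₁ le_rfl).trans h₁)
    (h₂.trans (sub_le_gibbsMean T hx₂ hr.le hr1 (mul_div_cancel₀ _ hr.ne').ge))
  have hx0 : 0 < x := hx₁.trans_le hxl
  refine ⟨x, hx0, hx, hxl, ?_⟩
  have hlast : x ^ (T + 1) / dI (T + 1) ≤ partFun (T + 1) x :=
    Finset.single_le_sum (f := fun i : Fin (T + 1) => x ^ (i.1 + 1) / dI (i.1 + 1))
      (fun i _ => (div_pos (pow_pos hx0 _) (dI_pos _)).le) (Finset.mem_univ (Fin.last T))
  have hP := partFun_pos (Nat.succ_pos T) hx0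
  have hw := gibbsWeight_succ x (T + 1)
  have h2 : 0 < (2 : ℝ) ^ (T + 1) * ((T + 1 : ℕ) + 1) := by positivity
  have hxr' : x * r ≤ 2 ^ T * ((T : ℝ) + 1) := (le_div_iff₀ hr).1 hxr
  have e1 : x ≤ 1 / (2 * r) * (2 ^ (T + 1) * ((T + 1 : ℕ) + 1)) := by
    rw [one_div, inv_mul_eq_div, le_div_iff₀ (by positivity)]
    push_cast
    have := pow_pos (show (0 : ℝ) < 2 by norm_num) T
    rw [pow_succ]
    nlinarith
  refine le_of_mul_le_mul_right ?_ h2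
  calc _ = _ := hw
    _ ≤ partFun (T + 1) x * (1 / (2 * r) * (2 ^ (T + 1) * ((T + 1 : ℕ) + 1))) := by gcongr
    _ = _ := by ring

lemma log_partFun_div_lower {ρ a s κ C L l lx α₀ : ℝ} (hl0 : 0 ≤ l)
    (hα : (α₀ - 1) * Real.log 2 = 2 * L - 2 * l + κ) (ha : a ≤ α₀) (ha' : α₀ ≤ a + 1)
    (haL : a ≤ 3 * L) (hLa : L ≤ a) (hL1 : 1 ≤ L)
    (hL : L / 2 + C ≤ L - l) (hC : C = 103 + |κ|) (hs : s = a - 101) (hρ : α₀ - 100 ≤ ρ)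
    (hlx : s * Real.log 2 + l - Real.log 2 ≤ lx) :
    a * (L - l) * (1 - 2 * (3 * C + 101) / L) ≤ ρ * (lx - L + 1) - 1 := by
  have l1 := Real.log_two_gt_d9
  have l2 := Real.log_two_lt_d9
  have hκ := neg_abs_le κ
  have hκ0 := abs_nonneg κ
  have h1 : (α₀ - 1) * Real.log 2 ≤ (s + 101) * Real.log 2 :=
    mul_le_mul_of_nonneg_right (by linarith) (by linarith)
  have h2 : L - l - C ≤ lx - L + 1 := by linarith
  have h3 : (a - 100) * (L - l - C) ≤ ρ * (lx - L + 1) :=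
    mul_le_mul (by linarith) h2 (by linarith) (by linarith)
  have hC0 : 0 ≤ C := by linarith
  have h4 : a * C ≤ 3 * L * C := mul_le_mul_of_nonneg_right haL hC0
  have h5 : L * (L / 2) ≤ a * (L - l) :=
    mul_le_mul hLa (by linarith) (by linarith) (by linarith)
  have h6 : L * (L / 2) * (2 * (3 * C + 101) / L) ≤ a * (L - l) * (2 * (3 * C + 101) / L) :=
    mul_le_mul_of_nonneg_right h5 (by positivity)
  have h7 : L * (L / 2) * (2 * (3 * C + 101) / L) = (3 * C + 101) * L := by field_simp
  linarith

lemma exp_neg_le_one_div {L : ℝ} (hL : 0 < L) : Real.exp (-L) ≤ 1 / L := by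
  rw [Real.exp_neg, one_div]
  gcongr
  linarith [Real.add_one_le_exp L]

lemma chernoff_factor_le_inv {L μ : ℝ} (hL : 3 ≤ L) (hμ : L ^ 5 ≤ μ) :
    (1 + 1 / L) ^ (-((1 + 1 / L) * μ)) * Real.exp (1 / L * μ) ≤ 1 / L := by
  have hL0 : 0 < L := by linarith
  have hμ0 : 0 ≤ μ := le_trans (by positivity) hμ
  refine (chernoff_factor_le (by positivity) ?_ hμ0).trans (le_trans ?_ (exp_neg_le_one_div hL0))
  · rw [div_le_one hL0]; linarith
  · rw [Real.exp_le_exp, neg_le_neg_iff]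
    calc L ≤ L ^ 3 / 3 := by nlinarith [mul_pos hL0 hL0]
      _ = L ^ 5 * (1 / L) ^ 2 / 3 := by field_simp
      _ ≤ _ := by gcongr

lemma choose_succ_mul_le_div {n a : ℕ} {C κ α₀ : ℝ} (hn : (0 : ℝ) < n) (hL : 0 < Real.log n)
    (hα : (α₀ - 1) * Real.log 2 = 2 * Real.log n - 2 * Real.log (Real.log n) + κ)
    (ha : α₀ - 1 ≤ a) (haL : Real.log n ≤ a + 1)
    (hμ : muR (1 / 2) a n ≤ C * n / Real.log n ^ 2) :
    n.choose (a + 1) * (1 / 2 : ℝ) ^ (a + 1).choose 2 ≤ |C| * Real.exp (-κ) / Real.log n := by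
  have hpow : (1 / 2 : ℝ) ^ a ≤ Real.exp (-((α₀ - 1) * Real.log 2)) := by
    rw [← Real.rpow_natCast, Real.rpow_def_of_pos (by norm_num), Real.exp_le_exp, one_div,
      Real.log_inv]
    have := mul_le_mul_of_nonneg_right ha (Real.log_nonneg (show (1 : ℝ) ≤ 2 by norm_num))
    linarith
  have hexp : Real.exp (-((α₀ - 1) * Real.log 2)) = Real.log n ^ 2 / n ^ 2 * Real.exp (-κ) := by
    have e1 : Real.exp (2 * Real.log (Real.log n)) = Real.log n ^ 2 := by
      rw [two_mul, Real.exp_add, Real.exp_log hL, sq]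
    have e2 : Real.exp (2 * Real.log n) = n ^ 2 := by
      rw [two_mul, Real.exp_add, Real.exp_log hn, sq]
    rw [hα, ← e1, ← e2, ← Real.exp_sub, ← Real.exp_add]
    ring_nf
  have hCle := le_abs_self C
  have hμ' : muR (1 / 2) a n ≤ |C| * n / Real.log n ^ 2 := hμ.trans (by gcongr)
  refine (choose_succ_mul_le n a).trans ?_
  calc muR (1 / 2) a n * (n * (1 / 2 : ℝ) ^ a / (a + 1))
      ≤ (|C| * n / Real.log n ^ 2) *
          (n * (Real.log n ^ 2 / n ^ 2 * Real.exp (-κ)) / Real.log n) := by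
        rw [hexp] at hpow
        gcongr
    _ = |C| * Real.exp (-κ) / Real.log n := by field_simp

lemma nuAl_bounds {n : ℕ} {C : ℝ} (hL : 1 ≤ Real.log n) (hμL : Real.log n ^ 5 ≤ muAl n)
    (hμC : muAl n ≤ C * n / Real.log n ^ 2) :
    Real.log n ≤ C * nuAl n ∧ nuAl n ≤ n := by
  have hL0 : 0 < Real.log n := by linarith
  have hμ1 : 1 ≤ muAl n := (one_le_pow₀ hL).trans hμL
  have hμ0 : 0 < muAl n := by linarith
  refine ⟨?_, ?_⟩
  · have hν : C * nuAl n = C * n / Real.log n ^ 2 * (Real.log n / muAl n) := by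
      unfold nuAl; field_simp
    rw [hν]
    calc Real.log n = muAl n * (Real.log n / muAl n) := by field_simp
      _ ≤ _ := by gcongr
  · unfold nuAl
    rw [div_div]
    exact div_le_self (Nat.cast_nonneg n) (one_le_mul_of_one_le_of_one_le hL hμ1)

set_option maxHeartbeats 2000000 in
lemma one_sub_gnpProb_chrom_le_div_log (C εc : ℝ) (hεc : 0 < εc) :
    ∃ A C' : ℝ, 0 < A ∧ ∀ᶠ n : ℕ in atTop, ∀ k : ℝ,
      Real.log n ^ 5 ≤ muAl n → muAl n ≤ C * n / Real.log n ^ 2 →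
      k ∈ Set.Icc ((n : ℝ) / ((alphaNat 2 n - 1 : ℕ) - εc / 4 : ℝ)) (n / (alpha0 2 n - 100)) →
      Lhat0 n k (alphaNat 2 n - 1) = 0 →
      1 - gnpProb n (1 / 2) {G | k - (1 + A / Real.log (nuAl n)) * muAl n * Real.log (nuAl n)
        / ((alphaNat 2 n : ℝ) * (Real.log n - Real.log (Real.log n))) ≤ (chrom G : ℝ)} ≤
        C' / Real.log n := by
  set κ : ℝ := 2 - 2 * Real.log 2 + 2 * Real.log (Real.log 2) with hκ
  set r : ℝ := (εc / 4) / (1 + εc / 4) with hr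
  have hr0 : 0 < r := by positivity
  have hr1 : r < 1 := by rw [hr, div_lt_one (by positivity)]; linarith
  have hrr : r / (1 - r) = εc / 4 := by
    rw [hr]; field_simp; ring
  set B : ℝ := 1 + 1 / (2 * r) with hB
  have hB1 : 1 ≤ B := le_add_of_nonneg_right (by positivity)
  set b := Real.log B with hb
  have hb0 : 0 ≤ b := Real.log_nonneg hB1
  set C₁ : ℝ := 103 + |κ| with hC₁
  have hC₁0 : 103 ≤ C₁ := by have := abs_nonneg κ; linarith
  set c : ℝ := 2 * (3 * C₁ + 101) with hc
  have hc0 : 0 ≤ c := by linarith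
  set A : ℝ := 2 * (c + 2 * b + 3) with hA
  refine ⟨A, |C| * Real.exp (-κ) + 1 + Real.exp 1, by linarith, ?_⟩
  filter_upwards [eventually_alpha0_bounds C₁, eventually_alpha0_bounds (2 * c + 3 * (|C| + 1)),
    eventually_alpha0_bounds (300 + εc)] with n h₁ h₂ h₃ k hμL hμC hk h0
  obtain ⟨-, hLl, -, hα3⟩ := h₁
  obtain ⟨hLc, -, -, -⟩ := h₂
  obtain ⟨hL300, -, hα0, -⟩ := h₃
  have hC0 := abs_nonneg C
  have hCle := le_abs_self C
  set L := Real.log n with hL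
  set l := Real.log L with hl
  have hL1 : 300 ≤ L := by linarith
  have hl0 : 0 ≤ l := Real.log_nonneg (by linarith)
  have hn0 : (0 : ℝ) < n := by
    rcases Nat.eq_zero_or_pos n with h | h
    · rw [hL, h] at hL1; norm_num at hL1
    · exact_mod_cast h
  have hid := alpha0_mul_log_two (y := n) (by rw [← hL]; linarith)
  rw [← hL, ← hl, ← hκ] at hid
  obtain ⟨ha₁, ha₂⟩ := alphaNat_bounds (y := n) (by linarith)
  have haL : L + 299 ≤ (alphaNat 2 n : ℝ) := by linarith
  obtain ⟨T, hT⟩ : ∃ T, alphaNat 2 n = T + 2 := by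
    have : (2 : ℝ) ≤ (alphaNat 2 n : ℝ) := by linarith
    exact ⟨alphaNat 2 n - 2, (Nat.sub_add_cancel (by exact_mod_cast this)).symm⟩
  obtain ⟨s, hs⟩ : ∃ s, T = s + 99 := by
    rw [hT] at haL
    push_cast at haL
    have : (99 : ℝ) ≤ T := by linarith
    exact ⟨T - 99, (Nat.sub_add_cancel (by exact_mod_cast this)).symm⟩
  set ν := nuAl n with hν
  set μ := muAl n with hμ
  have hνμ : ν = n / L / μ := by rw [hν, hμ, hL]; rfl
  have hμR : μ = n.choose (T + 2) * (1 / 2 : ℝ) ^ (T + 2).choose 2 := by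
    rw [hμ, muAl, hT, muR_half_eq]
  have hμ2 : 2 * L ≤ μ := by
    refine le_trans ?_ hμL
    have : 2 * L ≤ L * L := mul_le_mul_of_nonneg_right (by linarith) (by linarith)
    have h3 : (1 : ℝ) ≤ L ^ 3 := one_le_pow₀ (by linarith)
    calc 2 * L ≤ L * L * 1 := by linarith
      _ ≤ L * L * L ^ 3 := by gcongr
      _ = L ^ 5 := by ring
  have hμ0 : 0 < μ := by linarith
  rw [hT] at ha₁ ha₂ haL hk h0 ⊢
  simp only [Nat.add_succ_sub_one] at hk h0
  push_cast at ha₁ ha₂ haL hk ⊢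
  have hs' : (T : ℝ) = s + 99 := by rw [hs]; push_cast; ring
  obtain ⟨hk₁, hk₂⟩ := hk
  have hden : 0 < (T : ℝ) + 1 - εc / 4 := by linarith
  have hk0 : 0 < k := (div_pos hn0 hden).trans_le hk₁
  have hρ₁ : n / k ≤ (T : ℝ) + 1 - εc / 4 := by
    rw [div_le_iff₀ hk0]; rwa [div_le_iff₀' hden] at hk₁
  have hρ₂ : alpha0 2 n - 100 ≤ n / k := by
    rw [le_div_iff₀ hk0]; rwa [le_div_iff₀' (by linarith)] at hk₂
  have hkL : k ≤ n / L := hk₂.trans (by gcongr; linarith)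
  obtain ⟨x, hx0, hmean, hxl, hxw⟩ := exists_saddle (T := T) (s := s) (ρ := n / k)
    (by have : (1 : ℝ) ≤ s := by linarith
        exact_mod_cast this) (by omega) hr0 hr1 (by linarith) (by rw [hrr]; exact hρ₁)
  have hP := partFun_pos (Nat.succ_pos T) hx0
  have hΛ := log_partFun_div_eq (Nat.succ_pos T) hk0 hx0 hmean h0
  have hlx : (s : ℝ) * Real.log 2 + l - Real.log 2 ≤ Real.log x := by
    refine le_trans ?_ (Real.log_le_log (by positivity) hxl)
    rw [Real.log_div (by positivity) (by norm_num), Real.log_mul (by positivity) (by positivity),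
      Real.log_pow]
    have : l ≤ Real.log (s + 1) := Real.log_le_log (by linarith) (by linarith)
    linarith
  have hΛ₁ := log_partFun_div_lower (ρ := n / k) (a := T + 2) (s := s) (κ := κ) (C := C₁) (L := L)
    (l := l) (lx := Real.log x) (α₀ := alpha0 2 n) hl0 (by linarith) ha₁ (by linarith)
    (by linarith) (by linarith) (by linarith) hLl hC₁ (by linarith) hρ₂ hlx
  rw [← hL] at hΛ
  rw [← hΛ, ← hc] at hΛ₁
  set Λ := Real.log (partFun (T + 1) x / k) with hΛd
  set Y := ((T : ℝ) + 2) * (L - l) with hY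
  have hY0 : 0 < Y := by
    have : 0 < L - l := by linarith
    have : 0 < (T : ℝ) + 2 := by linarith
    positivity
  have hΛ0 : 0 ≤ Λ := by
    refine le_trans ?_ hΛ₁
    have : c / L ≤ 1 := by rw [div_le_one (by linarith)]; linarith
    exact mul_nonneg hY0.le (by linarith)
  have hu1 : k / partFun (T + 1) x ≤ 1 := by
    rw [div_le_one hP]
    rw [hΛd, Real.log_nonneg_iff (by positivity), one_le_div hk0] at hΛ0
    exact hΛ0
  have hνb := nuAl_bounds (C := C) (n := n) (by linarith) hμL hμC
  rw [← hν, ← hL] at hνb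
  have hνC : L ≤ |C| * ν := hνb.1.trans (by gcongr; rw [hνμ]; positivity)
  have hν1 : 1 < ν := by
    by_contra h
    have := mul_le_mul_of_nonneg_left (not_lt.1 h) hC0
    linarith
  have hlν0 : 0 < Real.log ν := Real.log_pos hν1
  have hlνL : Real.log ν ≤ L := Real.log_le_log (by linarith) hνb.2
  set z := 1 / (B * ν) with hz
  have hz0 : 0 < z := by positivity
  have hBν : 1 ≤ B * ν := one_le_mul_of_one_le_of_one_le hB1 hν1.le
  have hz1 : z ≤ 1 := by rw [hz, div_le_one (by linarith)]; exact hBν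
  have hlz : Real.log z = -(b + Real.log ν) := by
    rw [hz, one_div, Real.log_inv, Real.log_mul (by positivity) (by positivity)]
  set E := k / partFun (T + 1) x * z * (x ^ (T + 2) / dI (T + 2)) with hE
  have hEμ : E ≤ μ := by
    calc E ≤ k / partFun (T + 1) x * z * (1 / (2 * r) * partFun (T + 1) x) := by
          rw [hE]; gcongr
      _ = z * (1 / (2 * r)) * k := by field_simp
      _ ≤ z * B * (n / L) := by gcongr; rw [hB]; linarith
      _ = μ := by rw [hz, hνμ]; field_simp
  set Δ := (1 + A / Real.log ν) * μ * Real.log ν / Y with hΔ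
  have hmain := exponent_le_neg (Δ := Δ) (by linarith) hμ0.le hlν0 hlνL hY0 hc0 (by linarith) hb0 hA
    hΛ₁ hΔ
  have hbound := one_sub_gnpProb_chrom_le n (T + 1) (div_pos hk0 hP) hu1 hz0 hz1 hx0
    (θ := 1 / L) (by positivity) ((1 + 1 / L) * μ) (k - Δ)
  refine hbound.trans ?_
  have hn1 : 1 ≤ n := by exact_mod_cast hn0
  have hexpL := exp_neg_le_one_div (L := L) (by linarith)
  have hfirst : n.choose (T + 1 + 2) * (1 / 2 : ℝ) ^ (T + 1 + 2).choose 2 ≤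
      |C| * Real.exp (-κ) / L := by
    refine choose_succ_mul_le_div hn0 (by linarith) (a := T + 2) (α₀ := alpha0 2 n)
      (by linarith) ?_ ?_ (by rwa [muR_half_eq, ← hμR])
    · push_cast; linarith
    · push_cast; linarith
  have hsecond : (1 + 1 / L) ^ (-((1 + 1 / L) * μ)) *
      Real.exp (1 / L * (n.choose (T + 1 + 1) * (1 / 2 : ℝ) ^ (T + 1 + 1).choose 2)) ≤ 1 / L := by
    rw [← hμR]
    exact chernoff_factor_le_inv (by linarith) hμL
  have hthird := colouring_term_le hn1 (Nat.succ_pos T) hk0 hx0 hmean h0 hz0 ((1 + 1 / L) * μ) Δ E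
  have hthird' : Real.exp 1 * n * Real.exp (-Λ * Δ - (1 + 1 / L) * μ * Real.log z + E) ≤
      Real.exp 1 / L := by
    have h1 : Real.exp (-Λ * Δ - (1 + 1 / L) * μ * Real.log z + E) ≤ Real.exp (-L - L) := by
      rw [Real.exp_le_exp, hlz]
      linarith
    have h2 : Real.exp (-L - L) = 1 / n * Real.exp (-L) := by
      rw [sub_eq_add_neg, Real.exp_add, one_div]
      congr 1
      rw [Real.exp_neg, hL, Real.exp_log hn0]
    calc _ ≤ Real.exp 1 * n * (1 / n * (1 / L)) := by
          rw [h2] at h1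
          have := h1.trans (mul_le_mul_of_nonneg_left hexpL (by positivity))
          gcongr
      _ = _ := by field_simp
  have hsum := add_le_add (add_le_add hfirst hsecond) (hthird.trans hthird')
  calc _ ≤ _ := hsum
    _ = _ := by ring

/-- Take `p = 1/2` and `β(n) = α(n) − 1`.  Suppose `n` ranges over a
(strictly increasing) sequence of integers with `log⁵ n ≤ μ_{α(n)}(n) = O(n/log² n)`, and let
`k*(n)` be the unique `k ∈ I_n` with `L̂₀(n,k,β(n)) = 0`.  Then there is `ε(n) = O(1/log ν)`
(in particular `ε(n) → 0`) such that, whp,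
`χ(G_{n,1/2}) ≥ k*(n) − (1+ε(n)) μ log ν / (α (log n − log log n))`,
where `α = α(n)`, `μ = μ_{α(n)}(n)` and `ν = (n/log n)/μ`. -/
theorem chromatic_lower_bound_alphashift
    (nseq : ℕ → ℕ) (hmono : StrictMono nseq)
    (hμ : ∃ C : ℝ, ∀ᶠ j in atTop,
      Real.log (nseq j) ^ 5 ≤ muAl (nseq j) ∧
      muAl (nseq j) ≤ C * (nseq j : ℝ) / Real.log (nseq j) ^ 2)
    (kstar : ℕ → ℝ) (εc : ℝ) (hεc : 0 < εc)
    (hkstar : ∀ᶠ j in atTop,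
      kstar (nseq j) ∈ Set.Icc
          ((nseq j : ℝ) / ((alphaNat 2 (nseq j) - 1 : ℕ) - εc / 4 : ℝ))
          ((nseq j : ℝ) / (alpha0 2 (nseq j) - 100)) ∧
      Lhat0 (nseq j) (kstar (nseq j)) (alphaNat 2 (nseq j) - 1) = 0 ∧
      ∀ k ∈ Set.Icc ((nseq j : ℝ) / ((alphaNat 2 (nseq j) - 1 : ℕ) - εc / 4 : ℝ))
          ((nseq j : ℝ) / (alpha0 2 (nseq j) - 100)),
        Lhat0 (nseq j) k (alphaNat 2 (nseq j) - 1) = 0 → k = kstar (nseq j)) :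
    ∃ (εf : ℕ → ℝ) (Cf : ℝ),
      (∀ᶠ j in atTop, |εf (nseq j)| ≤ Cf / Real.log (nuAl (nseq j))) ∧
      Tendsto (fun j => εf (nseq j)) atTop (nhds 0) ∧
      Tendsto (fun j => gnpProb (nseq j) (1 / 2)
        {G | kstar (nseq j)
            - (1 + εf (nseq j)) * muAl (nseq j) * Real.log (nuAl (nseq j))
              / ((alphaNat 2 (nseq j) : ℝ)
                * (Real.log (nseq j) - Real.log (Real.log (nseq j))))
          ≤ (chrom G : ℝ)}) atTop (nhds 1) := by
  obtain ⟨C, hC⟩ := hμ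
  obtain ⟨A, C', hA, hmain⟩ := one_sub_gnpProb_chrom_le_div_log C εc hεc
  have hseq : Tendsto nseq atTop atTop := hmono.tendsto_atTop
  have hlog : Tendsto (fun j => Real.log (nseq j)) atTop atTop :=
    Real.tendsto_log_atTop.comp (tendsto_natCast_atTop_atTop.comp hseq)
  have hν : Tendsto (fun j => nuAl (nseq j)) atTop atTop := by
    have hC1 : 0 < |C| + 1 := by positivity
    refine tendsto_atTop_mono' atTop ?_ (hlog.atTop_div_const hC1)
    filter_upwards [hC, hlog.eventually_ge_atTop 1] with j hj hL
    have hμ0 : 0 ≤ muAl (nseq j) := le_trans (by positivity) hj.1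
    have hν0 : 0 ≤ nuAl (nseq j) := by unfold nuAl; positivity
    rw [div_le_iff₀' hC1]
    exact (nuAl_bounds hL hj.1 hj.2).1.trans
      (mul_le_mul_of_nonneg_right (by linarith [le_abs_self C]) hν0)
  have hlogν := Real.tendsto_log_atTop.comp hν
  refine ⟨fun n => A / Real.log (nuAl n), A, ?_, hlogν.const_div_atTop A, ?_⟩
  · filter_upwards [hlogν.eventually_ge_atTop 0] with j hj
    exact (abs_of_nonneg (div_nonneg hA.le hj)).le
  · have hlim : Tendsto (fun j => 1 - C' / Real.log (nseq j)) atTop (nhds 1) := by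
      simpa using (hlog.const_div_atTop C').const_sub 1
    refine tendsto_of_tendsto_of_tendsto_of_le_of_le' hlim tendsto_const_nhds ?_
      (Eventually.of_forall fun j => gnpProb_half_le_one _)
    filter_upwards [hC, hkstar, hseq.eventually hmain] with j hj hk hm
    linarith [hm _ hj.1 hj.2 hk.1 hk.2.1]
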